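/- arXiv:1606.08153 — 2 statements merged into one kernel-verified Lean document; each statement's English description precedes it below -/
import Mathlib

section
/- For any odd prime p, S_p ≡ 15 - 30p + 60p² (mod p³), where S_n = C(6n,3n)·C(3n,n)/(2(2n+1)·C(2n,n)). -/
/-- `S n = C(6n,3n)·C(3n,n) / (2(2n+1)·C(2n,n))` using natural division
(which is exact for `n ≥ 1`). -/
def S (n : ℕ) : ℕ :=
  Nat.choose (6 * n) (3 * n) * Nat.choose (3 * n) n / (2 * (2 * n + 1) * Nat.choose (2 * n) n)

open Polynomial in
/-- Over a finite prime field, `∏ (X + i)` over a full residue system is `X ^ p - X`. -/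
theorem prod_range_X_add_natCast_zmod (p : ℕ) [Fact p.Prime] :
    ∏ i ∈ Finset.range p, (X + C (i : ZMod p)) = X ^ p - X := by
  have hp1 : 1 < p := (Fact.out : p.Prime).one_lt
  have hroots : (X ^ p - X : (ZMod p)[X]).roots = Finset.univ.val := by
    have h := FiniteField.roots_X_pow_card_sub_X (ZMod p)
    rwa [ZMod.card] at h
  have hdeg : (X ^ p - X : (ZMod p)[X]).natDegree = p :=
    FiniteField.X_pow_card_sub_X_natDegree_eq _ hp1
  have hmonic : (X ^ p - X : (ZMod p)[X]).Monic :=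
    monic_X_pow_sub (by rw [degree_X]; exact_mod_cast hp1)
  have hprod := prod_multiset_X_sub_C_of_monic_of_roots_card_eq hmonic
    (by rw [hroots, hdeg]; simp [ZMod.card])
  rw [hroots] at hprod
  rw [← hprod]
  change _ = ∏ a : ZMod p, (X - C a)
  rw [← Equiv.prod_comp (Equiv.neg (ZMod p))]
  simp only [Equiv.neg_apply, map_neg, sub_neg_eq_add]
  refine Finset.prod_bij' (fun i _ => (i : ZMod p)) (fun a _ => a.val) ?_ ?_ ?_ ?_ ?_
  · simp
  · intro a _; simpa using a.val_lt
  · intro i hi; exact ZMod.val_cast_of_lt (Finset.mem_range.1 hi)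
  · intro a _; simp
  · intros; rfl

open Polynomial in
/-- For a prime `p ≥ 5`, each block of `p - 1` consecutive integers between multiples of `p` has
product congruent to `(p - 1)!` modulo `p ^ 3`. -/
theorem prod_block_modEq_factorial {p : ℕ} (hp : p.Prime) (h5 : 5 ≤ p) (m : ℕ) :
    (∏ i ∈ Finset.range (p - 1), ((m : ℤ) * p + (i + 1))) ≡ ((p - 1).factorial : ℤ)
      [ZMOD (p : ℤ) ^ 3] := by
  have := Fact.mk hp
  set f : ℤ[X] := ∏ i ∈ Finset.range (p - 1), (X + C ((i : ℤ) + 1)) with hf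
  have heval (x : ℤ) : f.eval x = ∏ i ∈ Finset.range (p - 1), (x + (i + 1)) := by
    simp [hf, eval_prod]
  have hc2 : (p : ℤ) ∣ f.coeff 2 := by
    rw [← ZMod.intCast_zmod_eq_zero_iff_dvd]
    have hX : X * f.map (Int.castRingHom (ZMod p)) = X ^ p - X := by
      rw [← prod_range_X_add_natCast_zmod p]
      obtain ⟨k, rfl⟩ : ∃ k, p = k + 1 := ⟨p - 1, by omega⟩
      rw [Finset.prod_range_succ']
      simp [hf, Polynomial.map_prod, mul_comm]
    have h := congrArg (fun g => coeff g 3) hX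
    simp only [coeff_X_mul, coeff_map, coeff_sub, coeff_X_pow, coeff_X] at h
    rw [if_neg (by omega), if_neg (by omega)] at h
    simpa using h
  have hexp : ∃ g : ℤ[X], ∀ x : ℤ,
      f.eval x = f.coeff 0 + f.coeff 1 * x + f.coeff 2 * x ^ 2 + x ^ 3 * g.eval x := by
    refine ⟨f.divX.divX.divX, fun x => ?_⟩
    have h0 := congrArg (eval x) (divX_mul_X_add f)
    have h1 := congrArg (eval x) (divX_mul_X_add f.divX)
    have h2 := congrArg (eval x) (divX_mul_X_add f.divX.divX)
    simp only [eval_add, eval_mul, eval_X, eval_C, coeff_divX] at h0 h1 h2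
    norm_num at h0 h1 h2
    rw [← h0, ← h1, ← h2]
    ring
  obtain ⟨g, hg⟩ := hexp
  obtain ⟨c, hc⟩ := hc2
  have hfac : f.eval 0 = ((p - 1).factorial : ℤ) := by
    rw [heval, Nat.factorial_eq_prod_range_add_one]
    push_cast
    simp only [zero_add]
  have hrefl : f.eval (-(p : ℤ)) = ((p - 1).factorial : ℤ) := by
    have heven : Even (p - 1) := hp.even_sub_one (by omega)
    have hneg : ((p - 1).factorial : ℤ) = ∏ i ∈ Finset.range (p - 1), (-1) * ((i : ℤ) + 1) := by
      rw [Finset.prod_mul_distrib, Finset.prod_const, Finset.card_range, heven.neg_one_pow,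
        one_mul, Nat.factorial_eq_prod_range_add_one]
      push_cast
      rfl
    rw [heval, hneg, ← Finset.prod_range_reflect]
    refine Finset.prod_congr rfl fun i hi => ?_
    have := Finset.mem_range.1 hi
    push_cast [show p - 1 - 1 - i = p - (i + 2) by omega, Nat.cast_sub (show i + 2 ≤ p by omega)]
    ring
  have h0 : f.coeff 0 = ((p - 1).factorial : ℤ) := by rw [← hfac, hg 0]; ring
  have h1 := hg (-(p : ℤ))
  rw [hrefl, h0, hc] at h1
  have h2 := hg ((m : ℤ) * p)
  rw [heval, h0, hc] at h2
  rw [h2]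
  refine (Int.modEq_iff_dvd.2 ⟨-(c * m ^ 2 + m ^ 3 * g.eval ((m : ℤ) * p)
    + m * (c - g.eval (-(p : ℤ)))), ?_⟩)
  linear_combination -(m : ℤ) * h1

/-- `(a p)! = a! p ^ a` times the product of the blocks prime to `p`. -/
theorem factorial_mul_eq_prod_blocks {p : ℕ} (hp : 0 < p) (a : ℕ) :
    ((a * p).factorial : ℤ) = a.factorial * (p : ℤ) ^ a *
      ∏ m ∈ Finset.range a, ∏ i ∈ Finset.range (p - 1), ((m : ℤ) * p + (i + 1)) := by
  induction a with
  | zero => simp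
  | succ a ih =>
    have h : ((a + 1) * p).factorial =
        (a * p).factorial * ∏ i ∈ Finset.range p, (a * p + (i + 1)) := by
      rw [Nat.factorial_eq_prod_range_add_one, Nat.factorial_eq_prod_range_add_one,
        add_mul, one_mul, Finset.prod_range_add]
      rfl
    obtain ⟨k, rfl⟩ : ∃ k, p = k + 1 := ⟨p - 1, by omega⟩
    rw [h, Nat.cast_mul, ih, Finset.prod_range_succ, Finset.prod_range_succ, Nat.factorial_succ]
    push_cast
    ring

theorem exists_factorial_mul_eq {p : ℕ} (hp : p.Prime) (h5 : 5 ≤ p) (a : ℕ) :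
    ∃ w : ℤ, ((a * p).factorial : ℤ) = a.factorial * (p : ℤ) ^ a * w ∧
      w ≡ ((p - 1).factorial : ℤ) ^ a [ZMOD (p : ℤ) ^ 3] := by
  refine ⟨_, factorial_mul_eq_prod_blocks hp.pos a, ?_⟩
  induction a with
  | zero => simp
  | succ a ih =>
    rw [Finset.prod_range_succ, pow_succ]
    exact ih.mul (prod_block_modEq_factorial hp h5 a)

theorem two_pow_mul_prod_odd_mul_factorial (k : ℕ) :
    2 ^ k * (∏ i ∈ Finset.range k, (2 * i + 1)) * k.factorial = (2 * k).factorial := by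
  induction k with
  | zero => simp
  | succ k ih =>
    rw [Finset.prod_range_succ, show 2 * (k + 1) = 2 * k + 1 + 1 by ring, Nat.factorial_succ,
      Nat.factorial_succ, Nat.factorial_succ, ← ih]
    ring

theorem two_mul_factorial_dvd_two_pow_mul_prod (k m : ℕ) :
    2 * (k + 1).factorial ∣
      2 ^ (k + 1) * ∏ i ∈ Finset.range (k + 1), (2 * m + 1 + 2 * i) := by
  induction k generalizing m with
  | zero => simp
  | succ k ihk =>
    induction m with
    | zero =>
      have h := two_pow_mul_prod_odd_mul_factorial (k + 2)
      have hc := Nat.two_dvd_centralBinom_succ (k + 1)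
      obtain ⟨c, hc⟩ := hc
      refine ⟨c, Nat.eq_of_mul_eq_mul_right (Nat.factorial_pos (k + 2)) ?_⟩
      have hch := Nat.choose_mul_factorial_mul_factorial
        (show k + 2 ≤ 2 * (k + 2) by omega)
      rw [← Nat.centralBinom_eq_two_mul_choose, hc,
        show 2 * (k + 2) - (k + 2) = k + 2 by omega, ← h] at hch
      simp only [mul_zero, zero_add, add_comm 1] at *
      rw [← hch]
      ring
    | succ m ihm =>
      have hstep : 2 ^ (k + 1 + 1) * ∏ i ∈ Finset.range (k + 1 + 1), (2 * (m + 1) + 1 + 2 * i) =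
          2 ^ (k + 1 + 1) * ∏ i ∈ Finset.range (k + 1 + 1), (2 * m + 1 + 2 * i) +
          4 * (k + 2) *
            (2 ^ (k + 1) * ∏ i ∈ Finset.range (k + 1), (2 * (m + 1) + 1 + 2 * i)) := by
        rw [Finset.prod_range_succ, Finset.prod_range_succ' (fun i => 2 * m + 1 + 2 * i),
          Finset.prod_congr rfl (fun i _ => show 2 * m + 1 + 2 * (i + 1) =
            2 * (m + 1) + 1 + 2 * i by ring)]
        ring
      rw [hstep]
      refine dvd_add ihm ?_
      obtain ⟨d, hd⟩ := ihk (m + 1)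
      rw [hd, Nat.factorial_succ (k + 1)]
      exact ⟨4 * d, by ring⟩

/-- The quotient defining `S n` is exact for `n ≥ 1`, in factorial form. -/
theorem S_mul_factorials {n : ℕ} (hn : 1 ≤ n) :
    2 * (2 * n + 1) * S n * ((3 * n).factorial * (2 * n).factorial ^ 2) =
      (6 * n).factorial * n.factorial := by
  have h6 := Nat.choose_mul_factorial_mul_factorial (show 3 * n ≤ 6 * n by omega)
  have h3 := Nat.choose_mul_factorial_mul_factorial (show n ≤ 3 * n by omega)
  have h2 := Nat.choose_mul_factorial_mul_factorial (show n ≤ 2 * n by omega)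
  rw [show 6 * n - 3 * n = 3 * n by omega] at h6
  rw [show 3 * n - n = 2 * n by omega] at h3
  rw [show 2 * n - n = n by omega] at h2
  have hodd1 := two_pow_mul_prod_odd_mul_factorial n
  have hodd3 := two_pow_mul_prod_odd_mul_factorial (3 * n)
  rw [show 2 * (3 * n) = 6 * n by ring, show 3 * n = n + 2 * n by ring, Finset.prod_range_add,
    show n + 2 * n = 3 * n by ring,
    Finset.prod_congr rfl (fun i _ => show 2 * (n + i) + 1 = 2 * n + 1 + 2 * i by ring)] at hodd3
  set P := ∏ i ∈ Finset.range (2 * n), (2 * n + 1 + 2 * i) with hP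
  obtain ⟨k, hk⟩ : ∃ k, 2 * n = k + 1 + 1 := ⟨2 * n - 2, by omega⟩
  have hPA := two_mul_factorial_dvd_two_pow_mul_prod (k + 1) n
  rw [← hk, ← hP] at hPA
  obtain ⟨A, hA⟩ := hPA
  obtain ⟨D, hD⟩ := two_mul_factorial_dvd_two_pow_mul_prod k (n + 1)
  have hPD : P = (2 * n + 1) * ∏ i ∈ Finset.range (k + 1), (2 * (n + 1) + 1 + 2 * i) := by
    rw [hP, hk, Finset.prod_range_succ', mul_comm]
    congr 1
    exact Finset.prod_congr rfl fun i _ => by omega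
  have hfac : (2 * n).factorial = 2 * n * (k + 1).factorial := by
    rw [hk, Nat.factorial_succ (k + 1)]
  have hAD : n * A = (2 * n + 1) * D := by
    refine Nat.eq_of_mul_eq_mul_left
      (show 0 < 4 * (k + 1).factorial by have := Nat.factorial_pos (k + 1); omega) ?_
    calc 4 * (k + 1).factorial * (n * A) = 2 * (2 * n * (k + 1).factorial) * A := by ring
      _ = 2 ^ (2 * n) * P := by rw [← hfac, hA]
      _ = 2 * (2 * n + 1) *
          (2 ^ (k + 1) * ∏ i ∈ Finset.range (k + 1), (2 * (n + 1) + 1 + 2 * i)) := by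
        rw [hPD, hk]; ring
      _ = _ := by rw [hD]; ring
  have hcop : Nat.Coprime (2 * n + 1) n := by
    rw [Nat.coprime_comm]; simp
  obtain ⟨B, rfl⟩ := hcop.dvd_of_dvd_mul_left ⟨D, hAD⟩
  have hid : 2 * (2 * n + 1) * B * ((3 * n).factorial * (2 * n).factorial ^ 2) =
      (6 * n).factorial * n.factorial := by
    calc _ = 2 * (2 * n).factorial * ((2 * n + 1) * B) *
          (3 * n).factorial * (2 * n).factorial := by ring
      _ = _ := by
        rw [← hA, ← hodd3, ← hodd1, show 3 * n = n + 2 * n by ring, pow_add]; ring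
  have hpos : 0 < 2 * (2 * n + 1) * Nat.choose (2 * n) n :=
    Nat.mul_pos (by omega) (Nat.choose_pos (by omega))
  have hS : S n = B := by
    unfold S
    refine Nat.div_eq_of_eq_mul_right hpos ?_
    have f1 := Nat.factorial_pos n
    have f2 := Nat.factorial_pos (2 * n)
    have f3 := Nat.factorial_pos (3 * n)
    refine Nat.eq_of_mul_eq_mul_right
      (show 0 < (3 * n).factorial ^ 2 * (n.factorial ^ 2 * (2 * n).factorial) by positivity) ?_
    calc _ = ((6 * n).choose (3 * n) * (3 * n).factorial * (3 * n).factorial) *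
          ((3 * n).choose n * n.factorial * (2 * n).factorial) * n.factorial := by ring
      _ = (2 * (2 * n + 1) * B * ((3 * n).factorial * (2 * n).factorial ^ 2)) *
          (3 * n).factorial := by rw [h6, h3, hid]; ring
      _ = 2 * (2 * n + 1) * B * ((3 * n).factorial * (2 * n).factorial *
          ((2 * n).choose n * n.factorial * n.factorial)) * (3 * n).factorial := by rw [h2]; ring
      _ = _ := by ring
  rw [hS, hid]

theorem Sp_congruence (p : ℕ) (hp : p.Prime) (hodd : Odd p) :
    Int.ModEq ((p : ℤ) ^ 3) (S p : ℤ) (15 - 30 * (p : ℤ) + 60 * (p : ℤ) ^ 2) := by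
  have h2 : p ≠ 2 := by rintro rfl; revert hodd; decide
  by_cases h3 : p = 3
  · subst h3
    rw [show S 3 = 14586 by norm_num [S, Nat.choose]]
    decide
  have h4 : p ≠ 4 := by rintro rfl; revert hp; decide
  have h5 : 5 ≤ p := by have := hp.two_le; omega
  obtain ⟨w₁, e₁, c₁⟩ := exists_factorial_mul_eq hp h5 1
  obtain ⟨w₂, e₂, c₂⟩ := exists_factorial_mul_eq hp h5 2
  obtain ⟨w₃, e₃, c₃⟩ := exists_factorial_mul_eq hp h5 3
  obtain ⟨w₆, e₆, c₆⟩ := exists_factorial_mul_eq hp h5 6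
  have hS : (2 * (2 * p + 1) * S p * ((3 * p).factorial * (2 * p).factorial ^ 2) : ℤ) =
      (6 * p).factorial * p.factorial := by exact_mod_cast S_mul_factorials hp.one_le
  rw [one_mul] at e₁
  rw [e₁, e₂, e₃, e₆] at hS
  norm_num [Nat.factorial] at hS
  have hp0 : (p : ℤ) ^ 7 ≠ 0 := pow_ne_zero _ (by exact_mod_cast hp.ne_zero)
  set F : ℕ := (p - 1).factorial
  have hw : (2 * p + 1) * (S p : ℤ) * 48 * (w₃ * w₂ ^ 2) = 720 * (w₆ * w₁) := by
    refine mul_left_cancel₀ hp0 ?_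
    linear_combination hS
  have hcong : (2 * p + 1) * (S p : ℤ) * 48 * ((F : ℤ) ^ 3 * ((F : ℤ) ^ 2) ^ 2) ≡
      720 * ((F : ℤ) ^ 6 * (F : ℤ) ^ 1) [ZMOD (p : ℤ) ^ 3] :=
    ((c₃.mul (c₂.pow 2)).symm.mul_left _).trans (hw ▸ (c₆.mul c₁).mul_left 720)
  have hcop : IsCoprime ((p : ℤ) ^ 3) (48 * (F : ℤ) ^ 7 * (2 * p + 1)) := by
    have h48 : Nat.Coprime p 48 := by
      rw [hp.coprime_iff_not_dvd, show 48 = 2 ^ 4 * 3 by norm_num, hp.dvd_mul]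
      rintro (h | h)
      · exact h2 ((Nat.prime_dvd_prime_iff_eq hp Nat.prime_two).1 (hp.dvd_of_dvd_pow h))
      · exact h3 ((Nat.prime_dvd_prime_iff_eq hp Nat.prime_three).1 h)
    have hF : Nat.Coprime p F := by
      rw [hp.coprime_iff_not_dvd, hp.dvd_factorial]
      omega
    have h21 : Nat.Coprime p (2 * p + 1) := by simp
    exact_mod_cast Nat.isCoprime_iff_coprime.2
      (((h48.mul_right (hF.pow_right 7)).mul_right h21).pow_left 3)
  obtain ⟨c, hc⟩ := hcong.symm.dvd
  refine (Int.modEq_iff_dvd.2 (hcop.dvd_of_dvd_mul_left ⟨c - 48 * (F : ℤ) ^ 7 * 120, ?_⟩)).symm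
  linear_combination hc
end

section
/- For all real x with |x| ≤ 1/(6√3), cos((2/3)·arcsin(6√3·x)) = 1 − ∑_{n≥1} (16^n/(3n-1))·C(3n,n)·x^{2n}, where the series on the right converges. -/
/-- The coefficient of `sin θ ^ (2 * m)` in the expansion of `-cos (2 * θ / 3)`. -/
noncomputable def cosCoeff (m : ℕ) : ℝ :=
  (4 / 27) ^ m / (3 * (m : ℝ) - 1) * Nat.choose (3 * m) m

theorem cosCoeff_zero : cosCoeff 0 = -1 := by
  norm_num [cosCoeff]

theorem cosCoeff_succ_pos (m : ℕ) : 0 < cosCoeff (m + 1) := by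
  have h : 0 < Nat.choose (3 * (m + 1)) (m + 1) := Nat.choose_pos (by omega)
  have h' : (0 : ℝ) < 3 * ((m + 1 : ℕ) : ℝ) - 1 := by
    push_cast
    linarith [m.cast_nonneg (α := ℝ)]
  unfold cosCoeff
  positivity

theorem choose_three_mul_succ (m : ℕ) :
    (2 * m + 2) * (2 * m + 1) * Nat.choose (3 * (m + 1)) (m + 1)
      = 3 * (3 * m + 2) * (3 * m + 1) * Nat.choose (3 * m) m := by
  have h₀ := Nat.add_choose_mul_factorial_mul_factorial (2 * m) m
  have h₁ := Nat.add_choose_mul_factorial_mul_factorial (2 * m + 2) (m + 1)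
  rw [show 2 * m + m = 3 * m by ring] at h₀
  rw [show 2 * m + 2 + (m + 1) = 3 * m + 2 + 1 by ring] at h₁
  simp only [Nat.factorial_succ] at h₁
  rw [← h₀] at h₁
  rw [show 3 * (m + 1) = 3 * m + 2 + 1 by ring]
  have hpos : 0 < (m + 1) * (Nat.factorial (2 * m) * Nat.factorial m) := by positivity
  apply Nat.eq_of_mul_eq_mul_right hpos
  linear_combination h₁

theorem cosCoeff_succ (m : ℕ) :
    (2 * (m : ℝ) + 2) * (2 * m + 1) * cosCoeff (m + 1) = (4 * (m : ℝ) ^ 2 - 4 / 9) * cosCoeff m := by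
  have h : (2 * (m : ℝ) + 2) * (2 * m + 1) * Nat.choose (3 * (m + 1)) (m + 1)
      = 3 * (3 * m + 2) * (3 * m + 1) * Nat.choose (3 * m) m := by
    exact_mod_cast choose_three_mul_succ m
  have h₁ : 3 * (m : ℝ) - 1 ≠ 0 := by
    intro h
    have : ((3 * m : ℕ) : ℝ) = (1 : ℕ) := by push_cast; linarith
    have := Nat.cast_injective this
    omega
  have h₂ : 3 * (m : ℝ) + 2 ≠ 0 := by positivity
  unfold cosCoeff
  push_cast
  rw [pow_succ, show 3 * ((m : ℝ) + 1) - 1 = 3 * m + 2 by ring,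
    show 4 * (m : ℝ) ^ 2 - 4 / 9 = 4 / 9 * (3 * m + 1) * (3 * m - 1) by ring]
  have hC : (4 / 9 * (3 * (m : ℝ) + 1) * (3 * m - 1))
        * ((4 / 27) ^ m / (3 * m - 1) * Nat.choose (3 * m) m)
      = 4 / 9 * (3 * m + 1) * (4 / 27) ^ m * Nat.choose (3 * m) m := by
    field_simp
  rw [hC, div_mul_eq_mul_div, mul_div_assoc', div_eq_iff h₂]
  linear_combination (4 / 27) ^ m * (4 / 27) * h

/-- `W = G' * sin (ω * (φ - θ)) + ω * G * cos (ω * (φ - θ))` with `ω = 2 / 3` and `G` the `N`-th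
partial sum of the expansion of `cos (2 * θ / 3)` in powers of `sin θ`. -/
noncomputable def partialWronskian (φ : ℝ) (N : ℕ) (θ : ℝ) : ℝ :=
  2 / 3 * Real.cos (2 / 3 * (φ - θ)) - ∑ k ∈ Finset.range N, cosCoeff (k + 1) *
    ((2 * (k : ℝ) + 2) * Real.sin θ ^ (2 * k + 1) * Real.cos θ * Real.sin (2 / 3 * (φ - θ))
      + 2 / 3 * Real.sin θ ^ (2 * k + 2) * Real.cos (2 / 3 * (φ - θ)))

theorem partialWronskian_zero (φ : ℝ) (N : ℕ) :
    partialWronskian φ N 0 = 2 / 3 * Real.cos (2 / 3 * φ) := by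
  simp [partialWronskian]

theorem partialWronskian_self (φ : ℝ) (N : ℕ) :
    partialWronskian φ N φ
      = 2 / 3 * (1 - ∑ k ∈ Finset.range N, cosCoeff (k + 1) * Real.sin φ ^ (2 * (k + 1))) := by
  simp only [partialWronskian, sub_self, mul_zero, Real.cos_zero, Real.sin_zero, mul_sub,
    Finset.mul_sum]
  congr 1
  refine Finset.sum_congr rfl fun k _ => ?_
  ring

theorem hasDerivAt_partialWronskian (φ : ℝ) (N : ℕ) (θ : ℝ) :
    HasDerivAt (partialWronskian φ N)
      ((4 * (N : ℝ) ^ 2 - 4 / 9) * cosCoeff N * Real.sin θ ^ (2 * N)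
        * Real.sin (2 / 3 * (φ - θ))) θ := by
  have hlin : HasDerivAt (fun θ : ℝ => 2 / 3 * (φ - θ)) (-(2 / 3)) θ := by
    simpa using ((hasDerivAt_id θ).const_sub φ).const_mul (2 / 3 : ℝ)
  induction N with
  | zero =>
    have h := hlin.cos.const_mul (2 / 3 : ℝ)
    refine (h.congr_deriv ?_).congr_of_eventuallyEq (.of_forall fun t => ?_)
    · rw [cosCoeff_zero]
      norm_num
      ring
    · simp [partialWronskian]
  | succ N ih =>
    have h₁ := ((((Real.hasDerivAt_sin θ).pow (2 * N + 1)).const_mul (2 * (N : ℝ) + 2)).mul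
      (Real.hasDerivAt_cos θ)).mul hlin.sin
    have h₂ := (((Real.hasDerivAt_sin θ).pow (2 * N + 2)).const_mul (2 / 3 : ℝ)).mul hlin.cos
    have h := ih.sub ((h₁.add h₂).const_mul (cosCoeff (N + 1)))
    refine (h.congr_deriv ?_).congr_of_eventuallyEq (.of_forall fun t => ?_)
    · rw [← cosCoeff_succ]
      simp only [Pi.mul_apply, Pi.pow_apply]
      simp only [Nat.add_sub_cancel, show 2 * N + 2 - 1 = 2 * N + 1 by omega]
      push_cast
      have hc := Real.cos_sq' θ
      linear_combination (-(2 * (N : ℝ) + 2) * (2 * N + 1) * cosCoeff (N + 1) * Real.sin θ ^ (2 * N)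
        * Real.sin (2 / 3 * (φ - θ))) * hc
    · simp only [partialWronskian, Finset.sum_range_succ, Pi.sub_apply, Pi.add_apply, Pi.mul_apply,
        Pi.pow_apply]
      ring

theorem cosCoeff_residual_nonneg (N : ℕ) : 0 ≤ (4 * (N : ℝ) ^ 2 - 4 / 9) * cosCoeff N := by
  rw [← cosCoeff_succ]
  have := cosCoeff_succ_pos N
  positivity

theorem sum_cosCoeff_le {φ : ℝ} (h₀ : 0 ≤ φ) (h₁ : φ ≤ Real.pi / 2) (N : ℕ) :
    ∑ k ∈ Finset.range N, cosCoeff (k + 1) * Real.sin φ ^ (2 * (k + 1))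
      ≤ 1 - Real.cos (2 / 3 * φ) := by
  have hmono : MonotoneOn (partialWronskian φ N) (Set.Icc 0 φ) := by
    refine monotoneOn_of_hasDerivWithinAt_nonneg (convex_Icc 0 φ)
      (fun t _ => (hasDerivAt_partialWronskian φ N t).continuousAt.continuousWithinAt)
      (fun t _ => (hasDerivAt_partialWronskian φ N t).hasDerivWithinAt) fun t ht => ?_
    rw [interior_Icc] at ht
    have hs : 0 ≤ Real.sin (2 / 3 * (φ - t)) :=
      Real.sin_nonneg_of_nonneg_of_le_pi (by linarith [ht.2]) (by linarith [ht.1, Real.pi_pos])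
    have hs' : 0 ≤ Real.sin t ^ (2 * N) := (even_two_mul N).pow_nonneg _
    exact mul_nonneg (mul_nonneg (cosCoeff_residual_nonneg N) hs') hs
  have h := hmono (Set.left_mem_Icc.2 h₀) (Set.right_mem_Icc.2 h₀) h₀
  rw [partialWronskian_zero, partialWronskian_self] at h
  linarith

theorem le_sum_cosCoeff {φ : ℝ} (h₀ : 0 ≤ φ) (h₁ : φ ≤ Real.pi / 2) (N : ℕ) :
    1 - Real.cos (2 / 3 * φ)
        - 3 / 2 * ((4 * (N : ℝ) ^ 2 - 4 / 9) * cosCoeff N * Real.sin φ ^ (2 * N)) * φ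
      ≤ ∑ k ∈ Finset.range N, cosCoeff (k + 1) * Real.sin φ ^ (2 * (k + 1)) := by
  have h := (convex_Icc 0 φ).norm_image_sub_le_of_norm_hasDerivWithin_le
    (C := (4 * (N : ℝ) ^ 2 - 4 / 9) * cosCoeff N * Real.sin φ ^ (2 * N))
    (fun t _ => (hasDerivAt_partialWronskian φ N t).hasDerivWithinAt)
    (fun t ht => by
      have hst : 0 ≤ Real.sin t :=
        Real.sin_nonneg_of_nonneg_of_le_pi ht.1 (by linarith [ht.2, Real.pi_pos])
      have hle : Real.sin t ≤ Real.sin φ :=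
        Real.sin_le_sin_of_le_of_le_pi_div_two (by linarith [ht.1, Real.pi_pos]) h₁ ht.2
      have hK := cosCoeff_residual_nonneg N
      rw [norm_mul, norm_mul, Real.norm_of_nonneg hK, Real.norm_of_nonneg (pow_nonneg hst _)]
      refine (mul_le_of_le_one_right (by positivity) (Real.abs_sin_le_one _)).trans ?_
      gcongr)
    (Set.left_mem_Icc.2 h₀) (Set.right_mem_Icc.2 h₀)
  rw [partialWronskian_zero, partialWronskian_self, sub_zero, Real.norm_of_nonneg h₀] at h
  have := (abs_le.1 h).2
  linarith

theorem summable_cosCoeff_mul_sin_pow {φ : ℝ} (h₀ : 0 ≤ φ) (h₁ : φ ≤ Real.pi / 2) :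
    Summable fun k : ℕ => cosCoeff (k + 1) * Real.sin φ ^ (2 * (k + 1)) :=
  summable_of_sum_range_le
    (fun k => mul_nonneg (cosCoeff_succ_pos k).le ((even_two_mul _).pow_nonneg _))
    (sum_cosCoeff_le h₀ h₁)

theorem tendsto_cosCoeff : Filter.Tendsto cosCoeff Filter.atTop (nhds 0) := by
  have h := summable_cosCoeff_mul_sin_pow (φ := Real.pi / 2) (by positivity) le_rfl
  simp only [Real.sin_pi_div_two, one_pow, mul_one] at h
  exact (Filter.tendsto_add_atTop_iff_nat 1).1 h.tendsto_atTop_zero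

theorem one_sub_cos_le_tsum {φ : ℝ} (h₀ : 0 ≤ φ) (h₁ : φ < Real.pi / 2) :
    1 - Real.cos (2 / 3 * φ) ≤ ∑' k : ℕ, cosCoeff (k + 1) * Real.sin φ ^ (2 * (k + 1)) := by
  have hs₀ : 0 ≤ Real.sin φ :=
    Real.sin_nonneg_of_nonneg_of_le_pi h₀ (by linarith [Real.pi_pos])
  have hs₁ : Real.sin φ < 1 := by
    rw [← Real.sin_pi_div_two]
    exact Real.sin_lt_sin_of_lt_of_le_pi_div_two (by linarith [Real.pi_pos]) le_rfl h₁
  have hr₁ : Real.sin φ ^ 2 < 1 := pow_lt_one₀ hs₀ hs₁ two_ne_zero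
  have hsq := tendsto_pow_const_mul_const_pow_of_lt_one 2 (sq_nonneg (Real.sin φ)) hr₁
  have hpow := tendsto_pow_atTop_nhds_zero_of_lt_one (sq_nonneg (Real.sin φ)) hr₁
  have hK : Filter.Tendsto
      (fun N : ℕ => (4 * (N : ℝ) ^ 2 - 4 / 9) * cosCoeff N * Real.sin φ ^ (2 * N))
      Filter.atTop (nhds 0) := by
    have := tendsto_cosCoeff.mul ((hsq.const_mul 4).sub (hpow.const_mul (4 / 9)))
    simp only [mul_zero, sub_zero] at this
    refine this.congr fun N => ?_
    rw [pow_mul]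
    ring
  have hlim := tendsto_const_nhds (x := 1 - Real.cos (2 / 3 * φ)) |>.sub
    ((hK.const_mul (3 / 2)).mul_const φ)
  simp only [mul_zero, zero_mul, sub_zero] at hlim
  exact le_of_tendsto_of_tendsto' hlim
    (summable_cosCoeff_mul_sin_pow h₀ h₁.le).hasSum.tendsto_sum_nat (le_sum_cosCoeff h₀ h₁.le)

theorem one_sub_cos_le_tsum_pi_div_two :
    1 - Real.cos (2 / 3 * (Real.pi / 2))
      ≤ ∑' k : ℕ, cosCoeff (k + 1) * Real.sin (Real.pi / 2) ^ (2 * (k + 1)) := by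
  have hcont : Continuous fun φ : ℝ => 1 - Real.cos (2 / 3 * φ) := by fun_prop
  have hlim := (hcont.tendsto (Real.pi / 2)).mono_left
    (nhdsWithin_le_nhds (s := Set.Iio (Real.pi / 2)))
  refine le_of_tendsto hlim ?_
  filter_upwards [Ioo_mem_nhdsLT (show (0 : ℝ) < Real.pi / 2 by positivity)] with φ hφ
  have hs₀ : 0 ≤ Real.sin φ :=
    Real.sin_nonneg_of_nonneg_of_le_pi hφ.1.le (by linarith [hφ.2, Real.pi_pos])
  refine (one_sub_cos_le_tsum hφ.1.le hφ.2).trans <|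
    (summable_cosCoeff_mul_sin_pow hφ.1.le hφ.2.le).tsum_le_tsum (fun k => ?_)
    (summable_cosCoeff_mul_sin_pow (by positivity) le_rfl)
  rw [Real.sin_pi_div_two]
  have := (cosCoeff_succ_pos k).le
  gcongr
  exact Real.sin_le_one φ

theorem hasSum_cosCoeff_mul_sin_pow {φ : ℝ} (h₀ : 0 ≤ φ) (h₁ : φ ≤ Real.pi / 2) :
    HasSum (fun k : ℕ => cosCoeff (k + 1) * Real.sin φ ^ (2 * (k + 1)))
      (1 - Real.cos (2 / 3 * φ)) := by
  have hS := summable_cosCoeff_mul_sin_pow h₀ h₁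
  have hle := le_of_tendsto' hS.hasSum.tendsto_sum_nat (sum_cosCoeff_le h₀ h₁)
  have hge : 1 - Real.cos (2 / 3 * φ)
      ≤ ∑' k : ℕ, cosCoeff (k + 1) * Real.sin φ ^ (2 * (k + 1)) := by
    rcases h₁.lt_or_eq with h | rfl
    · exact one_sub_cos_le_tsum h₀ h
    · exact one_sub_cos_le_tsum_pi_div_two
  rw [← le_antisymm hle hge]
  exact hS.hasSum

theorem cos_arcsin_series (x : ℝ) (hx : |x| ≤ 1 / (6 * Real.sqrt 3)) :
    HasSum (fun n : ℕ =>
      (16 ^ (n + 1) / (3 * ((n : ℝ) + 1) - 1)) * Nat.choose (3 * (n + 1)) (n + 1)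
        * x ^ (2 * (n + 1)))
      (1 - Real.cos ((2 / 3) * Real.arcsin (6 * Real.sqrt 3 * x))) := by
  have hy : 6 * Real.sqrt 3 * |x| ≤ 1 := by
    rwa [le_div_iff₀' (by positivity)] at hx
  have hy₀ : 0 ≤ 6 * Real.sqrt 3 * |x| := by positivity
  have h := hasSum_cosCoeff_mul_sin_pow (Real.arcsin_nonneg.2 hy₀) (Real.arcsin_le_pi_div_two _)
  have hcos : Real.cos (2 / 3 * Real.arcsin (6 * Real.sqrt 3 * |x|))
      = Real.cos (2 / 3 * Real.arcsin (6 * Real.sqrt 3 * x)) := by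
    rcases abs_choice x with hx' | hx'
    · rw [hx']
    · rw [hx', mul_neg, Real.arcsin_neg, mul_neg, Real.cos_neg]
  rw [hcos, Real.sin_arcsin (by linarith) hy] at h
  convert h using 2 with n
  have hsq : (6 * Real.sqrt 3 * |x|) ^ 2 = 108 * x ^ 2 := by
    rw [mul_pow, mul_pow, Real.sq_sqrt (by norm_num), sq_abs]
    norm_num
  rw [pow_mul, pow_mul (6 * Real.sqrt 3 * |x|), hsq, mul_pow 108, cosCoeff,
    show (16 : ℝ) = 4 / 27 * 108 by norm_num, mul_pow (4 / 27 : ℝ)]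
  push_cast
  ring
end
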